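/- Let Ω = Δ(A,B,C) be a nondegenerate triangle in ℝ², let k ≥ 1 be an integer, N = 4^k, and let P = (f_Ω(0), f_Ω(1), …, f_Ω(N−1)) be the first N triangular van der Corput points of Ω. Then D_N^P(P;Ω) = 2/(3√N) − 1/(9N). -/

import Mathlib

open MeasureTheory Filter Real

noncomputable section

/-- Points of the plane. -/
abbrev Pt := ℝ × ℝ

/-- The (closed) triangle with vertices `A`, `B`, `C`: their convex hull. -/
def triangle (A B C : Pt) : Set Pt := convexHull ℝ {A, B, C}

/-- The triangle `Δ(A,B,C)` is nondegenerate iff `A`, `B`, `C` are not collinear. -/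
def Nondeg (A B C : Pt) : Prop := ¬ Collinear ℝ ({A, B, C} : Set Pt)

/-- Two-dimensional Lebesgue volume, as a real number. -/
def vol (S : Set Pt) : ℝ := (volume S).toReal

/-- Signed discrepancy `δ_N(S; P, Ω)` of the list of points `P` at the set `S`,
relative to the domain `Ω`. -/
def sdisc {N : ℕ} (S : Set Pt) (P : Fin N → Pt) (Ω : Set Pt) : ℝ :=
  vol (S ∩ Ω) / vol Ω - (Nat.card {i : Fin N // P i ∈ S} : ℝ) / N

/-- Discrepancy `D_N(𝒮; P, Ω)`: supremum of the absolute signed discrepancy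
over a class `𝒮` of sets. -/
def Disc {N : ℕ} (𝒮 : Set (Set Pt)) (P : Fin N → Pt) (Ω : Set Pt) : ℝ :=
  ⨆ S ∈ 𝒮, |sdisc S P Ω|

/-- The half-open parallelogram `𝒯_{a,b,C}` anchored at `C` with sides
`a(A-C)` and `b(B-C)`. -/
def parlg (A B C : Pt) (a b : ℝ) : Set Pt :=
  {x | ∃ s t : ℝ, 0 ≤ s ∧ s < a ∧ 0 ≤ t ∧ t < b ∧ x = C + s • (A - C) + t • (B - C)}

/-- The family `𝒮_C` of parallelograms anchored at `C`, intersected with the triangle. -/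
def anchoredFam (A B C : Pt) : Set (Set Pt) :=
  {S | ∃ a b : ℝ, 0 < a ∧ a ≤ 1 ∧ 0 < b ∧ b ≤ 1 ∧ S = parlg A B C a b ∩ triangle A B C}

/-- The class `𝒮_A ∪ 𝒮_B ∪ 𝒮_C` of anchored parallelograms of the triangle `Δ(A,B,C)`. -/
def parFam (A B C : Pt) : Set (Set Pt) :=
  anchoredFam B C A ∪ anchoredFam A C B ∪ anchoredFam A B C

/-- The parallelogram discrepancy `D_N^P(P; Δ(A,B,C))`. -/
def parDisc {N : ℕ} (P : Fin N → Pt) (A B C : Pt) : ℝ :=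
  Disc (parFam A B C) P (triangle A B C)

/-- Midpoint of two points. -/
def mid (P Q : Pt) : Pt := (2⁻¹ : ℝ) • (P + Q)

/-- A triangle recorded as the (ordered) triple of its vertices. -/
abbrev Tri2 := Pt × Pt × Pt

/-- The centroid of a triangle: the average of its three vertices. -/
def ctr (T : Tri2) : Pt := (3⁻¹ : ℝ) • (T.1 + T.2.1 + T.2.2)

/-- The point set of a triangle given by its vertices. -/
def triSet (T : Tri2) : Set Pt := triangle T.1 T.2.1 T.2.2

/-- The four-way subdivision of a triangle: subtriangle number `d ∈ {0,1,2,3}`. -/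
def subdiv (T : Tri2) (d : ℕ) : Tri2 :=
  let A := T.1; let B := T.2.1; let C := T.2.2
  if d = 0 then (mid B C, mid A C, mid A B)
  else if d = 1 then (A, mid A B, mid A C)
  else if d = 2 then (mid A B, B, mid B C)
  else (mid A C, mid B C, C)

/-- The triangular van der Corput point `f_T(i)`: digits of `i` in base `4` select a
nested subtriangle, and `f_T(i)` is its centroid. -/
def vdc (T : Tri2) (i : ℕ) : Pt :=
  if h : i = 0 then ctr T else vdc (subdiv T (i % 4)) (i / 4)
termination_by i
decreasing_by exact Nat.div_lt_self (Nat.pos_of_ne_zero h) (by norm_num)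

/-- The `i`-th subtriangle (for `i < 4^k`) of the standard level-`k` subdivision of `T`,
indexed by the base-4 digits of `i`. -/
def subdivAt (T : Tri2) : ℕ → ℕ → Tri2
  | 0, _ => T
  | (k+1), i => subdiv (subdivAt T k (i / 4)) (i % 4)

/-- The standard level-`k` subdivision of a triangle: the set of the `4^k` congruent
subtriangles obtained by `k` recursive four-way subdivisions. -/
def level (T : Tri2) : ℕ → Set Tri2
  | 0 => {T}
  | (k+1) => {S | ∃ S' ∈ level T k, ∃ d < 4, S = subdiv S' d}

/-- Riemann integrability (in the triangular-subdivision sense) of `f` on the closed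
triangle `T`, with integral mean `μ`: every sequence of tagged Riemann sums over the
level-`k` subdivisions converges to `μ`. -/
def RiemannMean (T : Tri2) (f : Pt → ℝ) (μ : ℝ) : Prop :=
  ∀ x : ℕ → ℕ → Pt, (∀ k i, i < 4^k → x k i ∈ triSet (subdivAt T k i)) →
    Tendsto (fun k => (4^k : ℝ)⁻¹ * ∑ i ∈ Finset.range (4^k), f (x k i)) atTop (nhds μ)

/-- A real number is a quadratic irrational if it has the form `(a + b√c)/d` with
integers `a,b,c,d`, `b ≠ 0`, `d ≠ 0`, `c > 0` and `c` not a perfect square. -/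
def QuadIrr (θ : ℝ) : Prop :=
  ∃ a b c d : ℤ, b ≠ 0 ∧ d ≠ 0 ∧ 0 < c ∧ (∀ m : ℤ, c ≠ m ^ 2) ∧
    θ = ((a : ℝ) + (b : ℝ) * Real.sqrt (c : ℝ)) / (d : ℝ)

/-- Distance from a real number to the nearest integer. -/
def distToInt (x : ℝ) : ℝ := |x - round x|

/-- A real number `θ` is badly approximable if `n‖nθ‖ > c` for all positive `n`,
for some constant `c > 0`. -/
def BadlyApprox (θ : ℝ) : Prop :=
  ∃ c : ℝ, 0 < c ∧ ∀ n : ℕ, 0 < n → c < (n : ℝ) * distToInt ((n : ℝ) * θ)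

end

/-- The point with affine coordinates `(s, t)` in the frame with origin `C` and axes
`A - C`, `B - C`. -/
def affPt (A B C : Pt) (s t : ℝ) : Pt := C + s • (A - C) + t • (B - C)

theorem vdc_zero (T : Tri2) : vdc T 0 = ctr T := by
  rw [vdc, dif_pos rfl]

theorem vdc_four_mul_add (T : Tri2) (i d : ℕ) (hd : d < 4) :
    vdc T (4 * i + d) = vdc (subdiv T d) i := by
  by_cases h : 4 * i + d = 0
  · obtain ⟨rfl, rfl⟩ : i = 0 ∧ d = 0 := by omega
    rw [vdc_zero]
    simp only [vdc_zero, ctr, subdiv, if_true, mid]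
    module
  · rw [vdc, dif_neg h]
    congr 2 <;> omega

theorem sum_range_four_mul (f : ℕ → ℕ) (M : ℕ) :
    ∑ i ∈ Finset.range (4 * M), f i
      = ∑ i ∈ Finset.range M, f (4 * i + 0) + ∑ i ∈ Finset.range M, f (4 * i + 1)
        + ∑ i ∈ Finset.range M, f (4 * i + 2) + ∑ i ∈ Finset.range M, f (4 * i + 3) := by
  induction M with
  | zero => simp
  | succ M ih =>
    rw [show 4 * (M + 1) = 4 * M + 1 + 1 + 1 + 1 by ring]
    simp only [Finset.sum_range_succ, ih, add_zero]
    ring_nf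

theorem sum_vdc_succ (T : Tri2) (k : ℕ) (g : Pt → ℕ) :
    ∑ i ∈ Finset.range (4 ^ (k + 1)), g (vdc T i)
      = ∑ i ∈ Finset.range (4 ^ k), g (vdc (subdiv T 0) i)
        + ∑ i ∈ Finset.range (4 ^ k), g (vdc (subdiv T 1) i)
        + ∑ i ∈ Finset.range (4 ^ k), g (vdc (subdiv T 2) i)
        + ∑ i ∈ Finset.range (4 ^ k), g (vdc (subdiv T 3) i) := by
  rw [pow_succ', sum_range_four_mul]
  simp only [vdc_four_mul_add T _ 0 (by norm_num), vdc_four_mul_add T _ 1 (by norm_num),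
    vdc_four_mul_add T _ 2 (by norm_num), vdc_four_mul_add T _ 3 (by norm_num)]

theorem mid_comm (P Q : Pt) : mid P Q = mid Q P := by
  simp only [mid, add_comm]

theorem sum_vdc_rotate (k : ℕ) (g : Pt → ℕ) (A B C : Pt) :
    ∑ i ∈ Finset.range (4 ^ k), g (vdc (B, C, A) i)
      = ∑ i ∈ Finset.range (4 ^ k), g (vdc (A, B, C) i) := by
  induction k generalizing A B C with
  | zero =>
    simp only [pow_zero, Finset.sum_range_one, vdc_zero, ctr]
    congr 2
    abel
  | succ k ih =>
    rw [sum_vdc_succ, sum_vdc_succ]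
    have h0 := ih (mid B C) (mid A C) (mid A B)
    have h1 := ih A (mid A B) (mid A C)
    have h2 := ih (mid A B) B (mid B C)
    have h3 := ih (mid A C) (mid B C) C
    simp only [subdiv, if_true, if_false, one_ne_zero, OfNat.ofNat_ne_zero, OfNat.ofNat_ne_one,
      show (3 : ℕ) ≠ 2 by norm_num, mid_comm C A, mid_comm B A]
    rw [h0, h1, h2, h3]
    ring

theorem sum_vdc_swap (k : ℕ) (g : Pt → ℕ) (A B C : Pt) :
    ∑ i ∈ Finset.range (4 ^ k), g (vdc (A, C, B) i)
      = ∑ i ∈ Finset.range (4 ^ k), g (vdc (A, B, C) i) := by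
  induction k generalizing A B C with
  | zero =>
    simp only [pow_zero, Finset.sum_range_one, vdc_zero, ctr]
    congr 2
    abel
  | succ k ih =>
    rw [sum_vdc_succ, sum_vdc_succ]
    have h0 := ih (mid B C) (mid A C) (mid A B)
    have h1 := ih A (mid A B) (mid A C)
    have h2 := ih (mid A B) B (mid B C)
    have h3 := ih (mid A C) (mid B C) C
    simp only [subdiv, if_true, if_false, one_ne_zero, OfNat.ofNat_ne_zero, OfNat.ofNat_ne_one,
      show (3 : ℕ) ≠ 2 by norm_num, mid_comm C B]
    rw [h0, h1, h2, h3]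
    ring

/-- Sum of `u` over the upright cells and of `v` over the inverted cells of the triangular
grid with `n` cells on each side. -/
def gridSum (n : ℕ) (u v : ℕ → ℕ → ℕ) : ℕ :=
  ∑ i ∈ Finset.range n, ∑ j ∈ Finset.range n,
    ((if i + j < n then u i j else 0) + (if i + j + 1 < n then v i j else 0))

theorem sum_range_range_reflect (n : ℕ) (f : ℕ → ℕ → ℕ) :
    ∑ i ∈ Finset.range n, ∑ j ∈ Finset.range n, f (n - 1 - i) (n - 1 - j)
      = ∑ i ∈ Finset.range n, ∑ j ∈ Finset.range n, f i j := by
  rw [Finset.sum_range_reflect (fun i => ∑ j ∈ Finset.range n, f i (n - 1 - j)) n]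
  exact Finset.sum_congr rfl fun i _ => Finset.sum_range_reflect (fun j => f i j) n

theorem gridSum_two_mul (n : ℕ) (u v : ℕ → ℕ → ℕ) :
    gridSum (2 * n) u v
      = gridSum n (fun i j => v (n - 1 - i) (n - 1 - j)) (fun i j => u (n - 1 - i) (n - 1 - j))
        + gridSum n (fun i j => u (n + i) j) (fun i j => v (n + i) j)
        + gridSum n (fun i j => u i (n + j)) (fun i j => v i (n + j)) + gridSum n u v := by
  have key : gridSum n (fun i j => v (n - 1 - i) (n - 1 - j))
      (fun i j => u (n - 1 - i) (n - 1 - j))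
      = ∑ i ∈ Finset.range n, ∑ j ∈ Finset.range n,
        ((if i + j < n then 0 else u i j) + (if i + j + 1 < n then 0 else v i j)) := by
    rw [← sum_range_range_reflect n]
    refine Finset.sum_congr rfl fun i hi => Finset.sum_congr rfl fun j hj => ?_
    rw [Finset.mem_range] at hi hj
    by_cases h1 : i + j < n <;> by_cases h2 : i + j + 1 < n <;>
      by_cases h3 : n - 1 - i + (n - 1 - j) < n <;>
      by_cases h4 : n - 1 - i + (n - 1 - j) + 1 < n <;>
      first | omega | (simp only [h1, h2, h3, h4, if_true, if_false] <;> ring)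
  rw [key]
  unfold gridSum
  rw [two_mul, Finset.sum_range_add]
  simp only [Finset.sum_range_add, ← Finset.sum_add_distrib]
  refine Finset.sum_congr rfl fun i hi => Finset.sum_congr rfl fun j hj => ?_
  rw [Finset.mem_range] at hi hj
  rw [if_pos (show i + j < n + n by omega), if_pos (show i + j + 1 < n + n by omega),
    if_neg (show ¬ n + i + (n + j) < n + n by omega),
    if_neg (show ¬ n + i + (n + j) + 1 < n + n by omega)]
  have e1 : (i + (n + j) < n + n) = (i + j < n) := by apply propext; omega
  have e2 : (i + (n + j) + 1 < n + n) = (i + j + 1 < n) := by apply propext; omega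
  have e3 : (n + i + j < n + n) = (i + j < n) := by apply propext; omega
  have e4 : (n + i + j + 1 < n + n) = (i + j + 1 < n) := by apply propext; omega
  simp only [e1, e2, e3, e4]
  split_ifs <;> omega

theorem gridSum_congr {n : ℕ} {u v u' v' : ℕ → ℕ → ℕ}
    (hu : ∀ i j, i + j < n → u i j = u' i j) (hv : ∀ i j, i + j + 1 < n → v i j = v' i j) :
    gridSum n u v = gridSum n u' v' := by
  refine Finset.sum_congr rfl fun i _ => Finset.sum_congr rfl fun j _ => ?_
  split_ifs with h1 h2 <;> simp [*]

theorem sum_vdc_eq_gridSum (k : ℕ) (g : Pt → ℕ) (A B C : Pt) :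
    ∑ i ∈ Finset.range (4 ^ k), g (vdc (A, B, C) i)
      = gridSum (2 ^ k)
        (fun i j => g (affPt A B C ((i + 1 / 3) / 2 ^ k) ((j + 1 / 3) / 2 ^ k)))
        (fun i j => g (affPt A B C ((i + 2 / 3) / 2 ^ k) ((j + 2 / 3) / 2 ^ k))) := by
  induction k generalizing A B C with
  | zero =>
    simp only [pow_zero, Finset.sum_range_one, gridSum, vdc_zero, ctr, affPt]
    norm_num
    congr 1
    module
  | succ k ih =>
    rw [sum_vdc_succ, pow_succ' 2 k, gridSum_two_mul]
    simp only [subdiv, if_true, if_false, one_ne_zero, OfNat.ofNat_ne_zero, OfNat.ofNat_ne_one,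
      show (3 : ℕ) ≠ 2 by norm_num]
    have hn : (2 : ℝ) ^ k ≠ 0 := by positivity
    have hsub : ∀ i, i < 2 ^ k → ((2 ^ k - 1 - i : ℕ) : ℝ) = 2 ^ k - 1 - i := by
      intro i hi
      rw [Nat.sub_sub, Nat.cast_sub (by omega)]
      push_cast
      ring
    rw [ih, ih, ih, ih]
    refine congrArg₂ _ (congrArg₂ _ (congrArg₂ _ ?_ ?_) ?_) ?_ <;>
      refine gridSum_congr (fun i j hij => congrArg g ?_) (fun i j hij => congrArg g ?_)
    all_goals
      have hi : i < 2 ^ k := by omega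
      have hj : j < 2 ^ k := by omega
      simp only [affPt, mid, pow_succ', hsub, hi, hj, Nat.cast_add, Nat.cast_pow,
        Nat.cast_ofNat]
      ext <;>
      simp only [Prod.fst_add, Prod.snd_add, Prod.smul_fst, Prod.smul_snd, Prod.fst_sub,
        Prod.snd_sub, smul_eq_mul] <;>
      field_simp <;> ring

theorem sum_ite_add_lt (M p q : ℕ) (hp : p ≤ M + 1) (hq : q ≤ M + 1) :
    ((p + q : ℝ) ≤ M + 1 →
      ((∑ i ∈ Finset.range p, ∑ j ∈ Finset.range q, if i + j < M then 1 else 0 : ℕ) : ℝ)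
        = p * q) ∧
    ((M : ℝ) ≤ p + q →
      ((∑ i ∈ Finset.range p, ∑ j ∈ Finset.range q, if i + j < M then 1 else 0 : ℕ) : ℝ)
        = p * q - (p + q - M) * (p + q - M - 1) / 2) := by
  have hrow : ∀ i, (∑ j ∈ Finset.range q, if i + j < M then 1 else 0 : ℕ) = min q (M - i) := by
    intro i
    rw [← Finset.card_filter, ← Finset.card_range (min q (M - i))]
    congr 1
    ext j
    simp only [Finset.mem_filter, Finset.mem_range]
    omega
  simp only [hrow]
  induction p with
  | zero =>
    refine ⟨by simp, fun h => ?_⟩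
    rw [Nat.cast_zero, zero_add] at h
    have h' : M ≤ q := by exact_mod_cast h
    obtain rfl | rfl : q = M ∨ q = M + 1 := by omega
    · simp
    · simp
  | succ p ih =>
    obtain ⟨ih1, ih2⟩ := ih (by omega)
    rw [Finset.sum_range_succ]
    refine ⟨fun h => ?_, fun h => ?_⟩
    · have h' : p + 1 + q ≤ M + 1 := by exact_mod_cast h
      have h2 : ((p + q : ℕ) : ℝ) ≤ M := by exact_mod_cast (by omega : p + q ≤ M)
      push_cast at h2
      rw [min_eq_left (by omega : q ≤ M - p)]
      push_cast at ih1 ⊢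
      rw [ih1 (by linarith)]
      ring
    · have h' : M ≤ p + 1 + q := by exact_mod_cast h
      rcases Nat.lt_or_ge (p + q) M with h2 | h2
      · have e : (M : ℝ) = p + 1 + q := by exact_mod_cast (by omega : M = p + 1 + q)
        rw [min_eq_left (by omega : q ≤ M - p)]
        push_cast at ih1 ⊢
        rw [ih1 (by linarith), e]
        ring
      · have h3 : (M : ℝ) ≤ p + q := by exact_mod_cast h2
        rw [min_eq_right (by omega : M - p ≤ q)]
        push_cast [Nat.cast_sub (by omega : p ≤ M)] at ih2 ⊢
        rw [ih2 h3]
        ring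

theorem exists_thirds (n : ℕ) (x : ℝ) (h0 : 0 < x) (h1 : x ≤ n) :
    ∃ p q : ℕ, p ≤ n ∧ q ≤ n ∧ (∀ i : ℕ, (i : ℝ) + 1 / 3 < x ↔ i < p) ∧
      (∀ i : ℕ, (i : ℝ) + 2 / 3 < x ↔ i < q) ∧
      ((p = q ∧ |x - q| ≤ 1 / 3) ∨ (p = q + 1 ∧ |x - q - 1 / 2| ≤ 1 / 6)) := by
  have hP : ∀ i : ℕ, (i : ℝ) + 1 / 3 < x ↔ i < ⌈x - 1 / 3⌉₊ := fun i => by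
    rw [Nat.lt_ceil, lt_sub_iff_add_lt]
  have hQ : ∀ i : ℕ, (i : ℝ) + 2 / 3 < x ↔ i < ⌈x - 2 / 3⌉₊ := fun i => by
    rw [Nat.lt_ceil, lt_sub_iff_add_lt]
  generalize ⌈x - 1 / 3⌉₊ = p at hP
  generalize ⌈x - 2 / 3⌉₊ = q at hQ
  have hp1 : x ≤ p + 1 / 3 := not_lt.1 fun h => lt_irrefl _ ((hP p).1 h)
  have hq1 : x ≤ q + 2 / 3 := not_lt.1 fun h => lt_irrefl _ ((hQ q).1 h)
  have hp2 : p = 0 ∨ (p : ℝ) - 2 / 3 < x := by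
    rcases p with _ | p
    · exact Or.inl rfl
    · have := (hP p).2 (Nat.lt_succ_self p)
      right; push_cast; linarith
  have hq2 : q = 0 ∨ (q : ℝ) - 1 / 3 < x := by
    rcases q with _ | q
    · exact Or.inl rfl
    · have := (hQ q).2 (Nat.lt_succ_self q)
      right; push_cast; linarith
  have hp2' : (p : ℝ) - 2 / 3 < x := by
    rcases hp2 with rfl | h
    · push_cast; linarith
    · exact h
  have hq2' : (q : ℝ) - 1 / 3 < x := by
    rcases hq2 with rfl | h
    · push_cast; linarith
    · exact h
  have hpn : p < n + 1 := by
    have : (p : ℝ) < n + 1 := by linarith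
    exact_mod_cast this
  have hqn : q < n + 1 := by
    have : (q : ℝ) < n + 1 := by linarith
    exact_mod_cast this
  have hqp : q < p + 1 := by
    have : (q : ℝ) < p + 1 := by linarith
    exact_mod_cast this
  have hpq : p < q + 2 := by
    have : (p : ℝ) < q + 2 := by linarith
    exact_mod_cast this
  refine ⟨p, q, by omega, by omega, hP, hQ, ?_⟩
  obtain rfl | rfl : p = q ∨ p = q + 1 := by omega
  · left
    exact ⟨rfl, abs_le.2 ⟨by linarith, by linarith⟩⟩
  · right
    push_cast at hp2'
    exact ⟨rfl, abs_le.2 ⟨by linarith, by linarith⟩⟩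

theorem Nondeg.det_ne_zero {A B C : Pt} (h : Nondeg A B C) :
    (A.1 - C.1) * (B.2 - C.2) - (B.1 - C.1) * (A.2 - C.2) ≠ 0 := by
  intro hd
  apply h
  rw [collinear_iff_of_mem (p₀ := C) (by simp)]
  by_cases h1 : A.1 - C.1 = 0
  · by_cases h2 : A.2 - C.2 = 0
    · have hAC : A = C := Prod.ext (sub_eq_zero.1 h1) (sub_eq_zero.1 h2)
      refine ⟨B - C, ?_⟩
      rintro p (rfl | rfl | rfl)
      · exact ⟨0, by simp [hAC]⟩
      · exact ⟨1, by simp⟩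
      · exact ⟨0, by simp⟩
    · refine ⟨A - C, ?_⟩
      rintro p (rfl | rfl | rfl)
      · exact ⟨1, by simp⟩
      · refine ⟨(p.2 - C.2) / (A.2 - C.2), ?_⟩
        ext
        · simp only [vadd_eq_add, Prod.fst_add, Prod.smul_fst, Prod.fst_sub, smul_eq_mul]
          field_simp
          linarith
        · simp only [vadd_eq_add, Prod.snd_add, Prod.smul_snd, Prod.snd_sub, smul_eq_mul]
          field_simp
          ring
      · exact ⟨0, by simp⟩
  · refine ⟨A - C, ?_⟩
    rintro p (rfl | rfl | rfl)
    · exact ⟨1, by simp⟩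
    · refine ⟨(p.1 - C.1) / (A.1 - C.1), ?_⟩
      ext
      · simp only [vadd_eq_add, Prod.fst_add, Prod.smul_fst, Prod.fst_sub, smul_eq_mul]
        field_simp
        ring
      · simp only [vadd_eq_add, Prod.snd_add, Prod.smul_snd, Prod.snd_sub, smul_eq_mul]
        field_simp
        linarith
    · exact ⟨0, by simp⟩

theorem affPt_inj {A B C : Pt} (h : Nondeg A B C) {s t s' t' : ℝ}
    (he : affPt A B C s t = affPt A B C s' t') : s = s' ∧ t = t' := by
  have hd := h.det_ne_zero
  have h1 := congrArg Prod.fst he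
  have h2 := congrArg Prod.snd he
  simp only [affPt, Prod.fst_add, Prod.snd_add, Prod.smul_fst, Prod.smul_snd, Prod.fst_sub,
    Prod.snd_sub, smul_eq_mul] at h1 h2
  constructor
  · apply mul_right_cancel₀ hd
    linear_combination (B.2 - C.2) * h1 - (B.1 - C.1) * h2
  · apply mul_right_cancel₀ hd
    linear_combination (A.1 - C.1) * h2 - (A.2 - C.2) * h1

theorem mem_triangle_iff {A B C x : Pt} :
    x ∈ triangle A B C ↔ ∃ s t : ℝ, 0 ≤ s ∧ 0 ≤ t ∧ s + t ≤ 1 ∧ x = affPt A B C s t := by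
  simp only [triangle, affPt]
  rw [convexHull_insert (by simp), convexHull_pair, mem_convexJoin]
  constructor
  · rintro ⟨_, rfl, y, ⟨a, b, ha, hb, hab, rfl⟩, c, d, hc, hd, hcd, rfl⟩
    refine ⟨c, d * a, hc, by positivity, by nlinarith, ?_⟩
    obtain rfl : b = 1 - a := by linarith
    obtain rfl : c = 1 - d := by linarith
    module
  · rintro ⟨s, t, hs, ht, hst, rfl⟩
    refine ⟨A, rfl, ?_⟩
    rcases eq_or_lt_of_le (show 0 ≤ 1 - s by linarith) with h | h
    · obtain rfl : t = 0 := by linarith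
      obtain rfl : s = 1 := by linarith
      refine ⟨C, right_mem_segment ℝ B C, ?_⟩
      convert left_mem_segment ℝ A C using 1
      module
    · refine ⟨(t / (1 - s)) • B + (1 - t / (1 - s)) • C,
        ⟨t / (1 - s), 1 - t / (1 - s), by positivity, ?_, by ring, rfl⟩,
        s, 1 - s, hs, h.le, by ring, ?_⟩
      · rw [sub_nonneg, div_le_one h]
        linarith
      · have : t = (1 - s) * (t / (1 - s)) := by field_simp
        generalize t / (1 - s) = r at this
        subst this
        module

/-- The standard triangle, in affine coordinates. -/
def stdTri : Set Pt := {p | 0 ≤ p.1 ∧ 0 ≤ p.2 ∧ p.1 + p.2 ≤ 1}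

/-- The standard half-open rectangle cut by the standard triangle, in affine coordinates. -/
def stdBox (a b : ℝ) : Set Pt := {p | 0 ≤ p.1 ∧ p.1 < a ∧ 0 ≤ p.2 ∧ p.2 < b ∧ p.1 + p.2 ≤ 1}

theorem triangle_eq_image (A B C : Pt) :
    triangle A B C = (fun p : Pt => affPt A B C p.1 p.2) '' stdTri := by
  ext x
  rw [mem_triangle_iff]
  constructor
  · rintro ⟨s, t, hs, ht, hst, rfl⟩
    exact ⟨(s, t), ⟨hs, ht, hst⟩, rfl⟩
  · rintro ⟨⟨s, t⟩, ⟨hs, ht, hst⟩, rfl⟩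
    exact ⟨s, t, hs, ht, hst, rfl⟩

theorem parlg_inter_triangle_eq_image {A B C : Pt} (h : Nondeg A B C) (a b : ℝ) :
    parlg A B C a b ∩ triangle A B C
      = (fun p : Pt => affPt A B C p.1 p.2) '' stdBox a b := by
  ext x
  rw [Set.mem_inter_iff, mem_triangle_iff]
  constructor
  · rintro ⟨⟨s, t, hs, hsa, ht, htb, rfl⟩, s', t', hs', ht', hst, he⟩
    obtain ⟨rfl, rfl⟩ := affPt_inj h he
    exact ⟨(s, t), ⟨hs, hsa, ht, htb, hst⟩, rfl⟩
  · rintro ⟨⟨s, t⟩, ⟨hs, hsa, ht, htb, hst⟩, rfl⟩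
    exact ⟨⟨s, t, hs, hsa, ht, htb, rfl⟩, s, t, hs, ht, hst, rfl⟩

theorem exists_vol_affPt_image {A B C : Pt} (h : Nondeg A B C) :
    ∃ c : ℝ, c ≠ 0 ∧ ∀ S : Set Pt, vol ((fun p : Pt => affPt A B C p.1 p.2) '' S) = c * vol S := by
  set M : Matrix (Fin 2) (Fin 2) ℝ := !![A.1 - C.1, B.1 - C.1; A.2 - C.2, B.2 - C.2] with hM
  set L := Matrix.toLin (Module.Basis.finTwoProd ℝ) (Module.Basis.finTwoProd ℝ) M with hL
  refine ⟨|M.det|, ?_, fun S => ?_⟩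
  · rw [abs_ne_zero, hM, Matrix.det_fin_two_of]
    exact h.det_ne_zero
  · have e : (fun p : Pt => affPt A B C p.1 p.2) = (fun p => C + p) ∘ L := by
      funext p
      rw [Function.comp_apply, hL, hM, Matrix.toLin_finTwoProd_apply]
      ext <;> simp [affPt] <;> ring
    rw [e, Set.image_comp, vol, vol, Set.image_add_left, measure_preimage_add,
      Measure.addHaar_image_linearMap, ENNReal.toReal_mul,
      ENNReal.toReal_ofReal (abs_nonneg _), hL, LinearMap.det_toLin]

theorem vol_eq_integral {S : Set Pt} (hS : MeasurableSet S) {a : ℝ} (ha : 0 ≤ a) {f : ℝ → ℝ}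
    (hf : Continuous f) (hpos : ∀ s ∈ Set.Ico 0 a, 0 ≤ f s)
    (hout : ∀ p ∈ S, 0 ≤ p.1 ∧ p.1 ≤ a)
    (hin : ∀ s ∈ Set.Ico 0 a, volume (Prod.mk s ⁻¹' S) = ENNReal.ofReal (f s)) :
    vol S = ∫ s in 0..a, f s := by
  have hind : (fun s => volume (Prod.mk s ⁻¹' S))
      = (Set.Icc 0 a).indicator (fun s => volume (Prod.mk s ⁻¹' S)) := by
    funext s
    by_cases hs : s ∈ Set.Icc 0 a
    · rw [Set.indicator_of_mem hs]
    · rw [Set.indicator_of_notMem hs]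
      rw [Set.eq_empty_of_forall_notMem (s := Prod.mk s ⁻¹' S) fun t ht => hs (hout (s, t) ht),
        measure_empty]
  have h1 : volume S = ∫⁻ s in Set.Ico 0 a, ENNReal.ofReal (f s) := by
    rw [Measure.volume_eq_prod, Measure.prod_apply hS, hind,
      lintegral_indicator measurableSet_Icc, ← setLIntegral_congr Ico_ae_eq_Icc]
    exact setLIntegral_congr_fun measurableSet_Ico hin
  have hint : IntegrableOn f (Set.Ico 0 a) :=
    (hf.integrableOn_Icc (a := 0) (b := a)).mono_set Set.Ico_subset_Icc_self
  have hnn : 0 ≤ᵐ[volume.restrict (Set.Ico 0 a)] f :=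
    (ae_restrict_iff' measurableSet_Ico).2 (ae_of_all _ hpos)
  rw [vol, h1, ← ofReal_integral_eq_lintegral_ofReal hint hnn,
    ENNReal.toReal_ofReal (integral_nonneg_of_ae hnn), intervalIntegral.integral_of_le ha,
    integral_Ico_eq_integral_Ioc]

theorem vol_stdTri : vol stdTri = 1 / 2 := by
  have hm : MeasurableSet stdTri := by
    unfold stdTri
    measurability
  rw [vol_eq_integral hm zero_le_one (f := fun s => 1 - s) (by fun_prop)
    (fun s hs => by linarith [hs.2]) (fun p hp => ⟨hp.1, by linarith [hp.2.1, hp.2.2]⟩)]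
  · rw [intervalIntegral.integral_sub (by simp) (by simp)]
    simp
    norm_num
  · intro s hs
    have : Prod.mk s ⁻¹' stdTri = Set.Icc 0 (1 - s) := by
      ext t
      simp only [stdTri, Set.mem_preimage, Set.mem_ofPred_eq, Set.mem_Icc]
      exact ⟨fun h => ⟨h.2.1, by linarith [h.2.2]⟩, fun h => ⟨hs.1, h.1, by linarith [h.2]⟩⟩
    rw [this, Real.volume_Icc, sub_zero]

theorem integral_min_one_sub {a b : ℝ} (hb : b ≤ 1) :
    ∫ s in 0..a, min b (1 - s) = a * b - max (a + b - 1) 0 ^ 2 / 2 := by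
  have hconst : ∀ x, x ≤ 1 - b → ∫ s in 0..x, min b (1 - s) = x * b := by
    intro x hx
    rw [intervalIntegral.integral_congr (g := fun _ => b)]
    · simp
    · intro s hs
      have hs2 := hs.2
      refine min_eq_left ?_
      have : max 0 x ≤ 1 - b := max_le (by linarith) hx
      linarith
  rcases le_total a (1 - b) with h | h
  · rw [hconst a h, max_eq_right (by linarith)]
    ring
  · have hc : Continuous fun s : ℝ => min b (1 - s) := by fun_prop
    rw [← intervalIntegral.integral_add_adjacent_intervals (hc.intervalIntegrable 0 (1 - b))
      (hc.intervalIntegrable (1 - b) a), hconst _ le_rfl,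
      intervalIntegral.integral_congr (a := 1 - b) (g := fun s => 1 - s),
      intervalIntegral.integral_sub (by simp) (by simp), max_eq_left (by linarith)]
    · simp only [intervalIntegral.integral_const, integral_id, smul_eq_mul]
      ring
    · intro s hs
      rw [Set.uIcc_of_le h] at hs
      exact min_eq_right (by linarith [hs.1])

theorem vol_stdBox {a b : ℝ} (ha0 : 0 < a) (ha : a ≤ 1) (hb0 : 0 < b) (hb : b ≤ 1) :
    vol (stdBox a b) = a * b - max (a + b - 1) 0 ^ 2 / 2 := by
  have hm : MeasurableSet (stdBox a b) := by
    unfold stdBox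
    measurability
  rw [← integral_min_one_sub hb]
  refine vol_eq_integral hm ha0.le (by fun_prop)
    (fun s hs => le_min hb0.le (by linarith [hs.2])) (fun p hp => ⟨hp.1, hp.2.1.le⟩) ?_
  intro s hs
  rcases lt_or_ge (1 - s) b with h | h
  · have : Prod.mk s ⁻¹' stdBox a b = Set.Icc 0 (1 - s) := by
      ext t
      simp only [stdBox, Set.mem_preimage, Set.mem_ofPred_eq, Set.mem_Icc]
      exact ⟨fun h => ⟨h.2.2.1, by linarith [h.2.2.2.2]⟩,
        fun h => ⟨hs.1, hs.2, h.1, by linarith [h.2], by linarith [h.2]⟩⟩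
    rw [this, Real.volume_Icc, sub_zero, min_eq_right h.le]
  · have : Prod.mk s ⁻¹' stdBox a b = Set.Ico 0 b := by
      ext t
      simp only [stdBox, Set.mem_preimage, Set.mem_ofPred_eq, Set.mem_Ico]
      exact ⟨fun h => ⟨h.2.2.1, h.2.2.2.1⟩,
        fun h => ⟨hs.1, hs.2, h.1, h.2, by linarith [h.2]⟩⟩
    rw [this, Real.volume_Ico, sub_zero, min_eq_left h]

theorem sdisc_parlg_eq {A B C : Pt} (h : Nondeg A B C) {n N : ℕ} (hn : 0 < n) (P : Fin N → Pt)
    (hP : ∀ g : Pt → ℕ, ∑ i, g (P i) = gridSum n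
        (fun i j => g (affPt A B C ((i + 1 / 3) / n) ((j + 1 / 3) / n)))
        (fun i j => g (affPt A B C ((i + 2 / 3) / n) ((j + 2 / 3) / n))))
    {a b : ℝ} (ha0 : 0 < a) (ha : a ≤ 1) (hb0 : 0 < b) (hb : b ≤ 1) :
    sdisc (parlg A B C a b ∩ triangle A B C) P (triangle A B C)
      = 2 * a * b - max (a + b - 1) 0 ^ 2
        - (gridSum n
          (fun i j => if (i : ℝ) + 1 / 3 < n * a ∧ (j : ℝ) + 1 / 3 < n * b then 1 else 0)
          (fun i j => if (i : ℝ) + 2 / 3 < n * a ∧ (j : ℝ) + 2 / 3 < n * b then 1 else 0) : ℕ)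
          / N := by
  classical
  have hn' : (0 : ℝ) < n := by exact_mod_cast hn
  obtain ⟨c, hc, hvol⟩ := exists_vol_affPt_image h
  have hmem : ∀ s t : ℝ, 0 ≤ s → 0 ≤ t → s + t ≤ 1 →
      (affPt A B C s t ∈ parlg A B C a b ∩ triangle A B C ↔ s < a ∧ t < b) := by
    intro s t hs ht hst
    rw [parlg_inter_triangle_eq_image h]
    constructor
    · rintro ⟨⟨s', t'⟩, hp, he⟩
      obtain ⟨rfl, rfl⟩ := affPt_inj h he
      exact ⟨hp.2.1, hp.2.2.2.1⟩
    · rintro ⟨h1, h2⟩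
      exact ⟨(s, t), ⟨hs, h1, ht, h2, hst⟩, rfl⟩
  rw [sdisc, Set.inter_assoc, Set.inter_self]
  congr 1
  · rw [parlg_inter_triangle_eq_image h, triangle_eq_image, hvol, hvol, mul_div_mul_left _ _ hc,
      vol_stdTri, vol_stdBox ha0 ha hb0 hb]
    ring
  · congr 2
    rw [Nat.card_eq_fintype_card, Fintype.card_subtype, Finset.card_filter,
      hP fun x => if x ∈ parlg A B C a b ∩ triangle A B C then 1 else 0]
    refine gridSum_congr (fun i j hij => ?_) (fun i j hij => ?_)
    · have hij' : (i : ℝ) + j + 1 ≤ n := by exact_mod_cast hij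
      simp only [hmem _ _ (show 0 ≤ ((i : ℝ) + 1 / 3) / n by positivity)
        (show 0 ≤ ((j : ℝ) + 1 / 3) / n by positivity)
        (by rw [← add_div, div_le_one hn']; linarith), div_lt_iff₀' hn']
    · have hij' : (i : ℝ) + j + 1 + 1 ≤ n := by exact_mod_cast hij
      simp only [hmem _ _ (show 0 ≤ ((i : ℝ) + 2 / 3) / n by positivity)
        (show 0 ≤ ((j : ℝ) + 2 / 3) / n by positivity)
        (by rw [← add_div, div_le_one hn']; linarith), div_lt_iff₀' hn']

theorem sum_range_ite_lt {n p : ℕ} (hp : p ≤ n) (f : ℕ → ℕ) :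
    ∑ i ∈ Finset.range n, (if i < p then f i else 0) = ∑ i ∈ Finset.range p, f i := by
  rw [← Finset.sum_filter]
  congr 1
  ext i
  simp only [Finset.mem_filter, Finset.mem_range]
  omega

theorem gridSum_ite_lt {n p q p' q' : ℕ} (hp : p ≤ n) (hq : q ≤ n) (hp' : p' ≤ n)
    (hq' : q' ≤ n) :
    gridSum n (fun i j => if i < p ∧ j < p' then 1 else 0)
        (fun i j => if i < q ∧ j < q' then 1 else 0)
      = (∑ i ∈ Finset.range p, ∑ j ∈ Finset.range p', if i + j < n then 1 else 0)
        + ∑ i ∈ Finset.range q, ∑ j ∈ Finset.range q', if i + j < n - 1 then 1 else 0 := by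
  simp only [← sum_range_ite_lt hp, ← sum_range_ite_lt hq, ← sum_range_ite_lt hp',
    ← sum_range_ite_lt hq', ← Finset.sum_add_distrib, gridSum]
  refine Finset.sum_congr rfl fun i _ => ?_
  have e : ∀ j, (i + j < n - 1) = (i + j + 1 < n) := fun j => by apply propext; omega
  simp only [e]
  by_cases h1 : i < p <;> by_cases h2 : i < q <;>
    simp only [h1, h2, if_true, if_false, true_and, false_and, add_zero, zero_add,
      ← Finset.sum_add_distrib, ite_self, Finset.sum_const_zero]
  all_goals
    refine Finset.sum_congr rfl fun j _ => ?_
    split_ifs <;> rfl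

/-- Both parameters are near integers. -/
theorem abs_le_of_near_near {n m m' : ℕ} (hn : 2 ≤ n) (hm : m ≤ n) (hm' : m' ≤ n) {x y K L : ℝ}
    (hx0 : 0 < x) (hxn : x ≤ n) (hy0 : 0 < y) (hyn : y ≤ n)
    (hx : |x - m| ≤ 1 / 3) (hy : |y - m'| ≤ 1 / 3)
    (hK1 : (m + m' : ℝ) ≤ n + 1 → K = m * m')
    (hK2 : (n : ℝ) ≤ m + m' → K = m * m' - (m + m' - n) * (m + m' - n - 1) / 2)
    (hL1 : (m + m' : ℝ) ≤ n → L = m * m')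
    (hL2 : (n : ℝ) - 1 ≤ m + m' → L = m * m' - (m + m' - n + 1) * (m + m' - n) / 2) :
    |2 * x * y - max (x + y - n) 0 ^ 2 - (K + L)| ≤ 2 / 3 * (n : ℝ) - 1 / 9 := by
  obtain ⟨u, rfl⟩ : ∃ u, x = m + u := ⟨x - m, by ring⟩
  obtain ⟨v, rfl⟩ : ∃ v, y = m' + v := ⟨y - m', by ring⟩
  rw [add_sub_cancel_left, abs_le] at hx hy
  have hn2 : (2 : ℝ) ≤ n := by exact_mod_cast hn
  have hm1 : (m : ℝ) ≤ n := by exact_mod_cast hm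
  have hm1' : (m' : ℝ) ≤ n := by exact_mod_cast hm'
  have hm0 : (0 : ℝ) ≤ m := m.cast_nonneg
  have hm0' : (0 : ℝ) ≤ m' := m'.cast_nonneg
  obtain ⟨hu1, hu2⟩ := hx
  obtain ⟨hv1, hv2⟩ := hy
  rcases lt_trichotomy (m + m') n with h | h | h
  · have h' : (m : ℝ) + m' + 1 ≤ n := by exact_mod_cast h
    rw [hK1 (by linarith), hL1 (by linarith), max_eq_right (by linarith), abs_le]
    constructor <;> nlinarith [mul_nonneg hm0 (sub_nonneg.2 hv2), mul_nonneg hm0 (sub_nonneg.2 hv1),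
      mul_nonneg hm0' (sub_nonneg.2 hu2), mul_nonneg hm0' (sub_nonneg.2 hu1),
      mul_nonneg (sub_nonneg.2 hu1) (sub_nonneg.2 hv2),
      mul_nonneg (sub_nonneg.2 hu2) (sub_nonneg.2 hv1),
      mul_nonneg (sub_nonneg.2 hu1) (sub_nonneg.2 hv1),
      mul_nonneg (sub_nonneg.2 hu2) (sub_nonneg.2 hv2)]
  · have h' : (m : ℝ) + m' = n := by exact_mod_cast h
    rw [hK1 (by linarith), hL1 (by linarith)]
    clear hK1 hK2 hL1 hL2
    have hz : (m : ℝ) = 0 ∨ (1 : ℝ) ≤ m := by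
      rcases m.eq_zero_or_pos with h0 | h0
      · left; exact_mod_cast h0
      · right; exact_mod_cast h0
    have hz' : (m' : ℝ) = 0 ∨ (1 : ℝ) ≤ m' := by
      rcases m'.eq_zero_or_pos with h0 | h0
      · left; exact_mod_cast h0
      · right; exact_mod_cast h0
    generalize (n : ℝ) = N at *
    generalize (m : ℝ) = r at *
    generalize (m' : ℝ) = r' at *
    obtain rfl : N = r + r' := h'.symm
    rcases le_total (u + v) 0 with hs | hs
    · rw [max_eq_right (by linarith), abs_le]
      rcases hz with rfl | hz <;> rcases hz' with rfl | hz'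
      · linarith
      · constructor <;> nlinarith
      · constructor <;> nlinarith
      · constructor
        · nlinarith [mul_nonneg (show 0 ≤ r + u by linarith) (sub_nonneg.2 hv1)]
        · rcases le_total u 0 with h0 | h0
          · nlinarith [mul_nonneg (show 0 ≤ r + u by linarith) (sub_nonneg.2 hv2)]
          · nlinarith [mul_nonneg (show 0 ≤ r' + v by linarith) (sub_nonneg.2 hu2)]
    · rw [max_eq_left (by linarith), abs_le]
      rcases hz with rfl | hz <;> rcases hz' with rfl | hz'
      · linarith
      · constructor
        · nlinarith
        · nlinarith [mul_nonneg (sub_nonneg.2 hu2) (show 0 ≤ 2 * r' - u - 1 / 3 by linarith)]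
      · constructor
        · nlinarith
        · nlinarith [mul_nonneg (sub_nonneg.2 hv2) (show 0 ≤ 2 * r - v - 1 / 3 by linarith)]
      · constructor
        · rcases le_total u 0 with h0 | h0
          · nlinarith [mul_nonneg (show 0 ≤ r - 1 by linarith) (show 0 ≤ v by linarith),
              mul_nonneg (show 0 ≤ r' - 1 by linarith) (sub_nonneg.2 hu1)]
          · nlinarith [mul_nonneg (show 0 ≤ r' - 1 by linarith) (show 0 ≤ u by linarith),
              mul_nonneg (show 0 ≤ r - 1 by linarith) (sub_nonneg.2 hv1)]
        · nlinarith [mul_nonneg (sub_nonneg.2 hu2) (show 0 ≤ 2 * r' - u - 1 / 3 by linarith),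
            mul_nonneg (sub_nonneg.2 hv2) (show 0 ≤ 2 * r - v - 1 / 3 by linarith)]
  · have h' : (n : ℝ) + 1 ≤ m + m' := by exact_mod_cast h
    rw [hK2 (by linarith), hL2 (by linarith), max_eq_left (by linarith), abs_le]
    constructor
    · linarith [mul_nonneg (sub_nonneg.2 hm1) (sub_nonneg.2 hu1),
        mul_nonneg (sub_nonneg.2 hm1') (sub_nonneg.2 hv1),
        mul_nonneg (sub_nonneg.2 hu1) (sub_nonneg.2 hu2),
        mul_nonneg (sub_nonneg.2 hv1) (sub_nonneg.2 hv2)]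
    · linarith [mul_nonneg (sub_nonneg.2 hm1) (sub_nonneg.2 hu2),
        mul_nonneg (sub_nonneg.2 hm1') (sub_nonneg.2 hv2), sq_nonneg u, sq_nonneg v]

/-- The first parameter is near an integer, the second near a half-integer. -/
theorem abs_le_of_near_mid {n m m' : ℕ} (hn : 2 ≤ n) (hm : m ≤ n) (hm' : m' + 1 ≤ n)
    {x y K L : ℝ} (hx0 : 0 < x)
    (hx : |x - m| ≤ 1 / 3) (hy : |y - m' - 1 / 2| ≤ 1 / 6)
    (hK1 : (m + (m' + 1) : ℝ) ≤ n + 1 → K = m * (m' + 1))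
    (hK2 : (n : ℝ) ≤ m + (m' + 1) →
      K = m * (m' + 1) - (m + (m' + 1) - n) * (m + (m' + 1) - n - 1) / 2)
    (hL1 : (m + m' : ℝ) ≤ n → L = m * m')
    (hL2 : (n : ℝ) - 1 ≤ m + m' → L = m * m' - (m + m' - n + 1) * (m + m' - n) / 2) :
    |2 * x * y - max (x + y - n) 0 ^ 2 - (K + L)| ≤ 2 / 3 * (n : ℝ) - 1 / 9 := by
  obtain ⟨u, rfl⟩ : ∃ u, x = m + u := ⟨x - m, by ring⟩
  obtain ⟨v, rfl⟩ : ∃ v, y = m' + 1 / 2 + v := ⟨y - m' - 1 / 2, by ring⟩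
  rw [show (m' : ℝ) + 1 / 2 + v - m' - 1 / 2 = v by ring, abs_le] at hy
  rw [add_sub_cancel_left, abs_le] at hx
  have hn2 : (2 : ℝ) ≤ n := by exact_mod_cast hn
  have hm1 : (m : ℝ) ≤ n := by exact_mod_cast hm
  have hm1' : (m' : ℝ) + 1 ≤ n := by exact_mod_cast hm'
  have hm0 : (0 : ℝ) ≤ m := m.cast_nonneg
  have hm0' : (0 : ℝ) ≤ m' := m'.cast_nonneg
  obtain ⟨hu1, hu2⟩ := hx
  obtain ⟨hv1, hv2⟩ := hy
  rcases Nat.lt_or_ge (m + m') n with h | h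
  · have h' : (m : ℝ) + m' + 1 ≤ n := by exact_mod_cast h
    rw [hK1 (by linarith), hL1 (by linarith), max_eq_right (by linarith), abs_le]
    have hz : (m : ℝ) = 0 ∨ (1 : ℝ) ≤ m := by
      rcases m.eq_zero_or_pos with h0 | h0
      · left; exact_mod_cast h0
      · right; exact_mod_cast h0
    rcases hz with hz | hz
    · rw [hz] at *
      constructor <;> nlinarith
    · constructor
      · nlinarith [mul_nonneg (show 0 ≤ m + u by linarith) (sub_nonneg.2 hv1)]
      · nlinarith [mul_nonneg (show 0 ≤ m + u by linarith) (sub_nonneg.2 hv2)]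
  · have h' : (n : ℝ) ≤ m + m' := by exact_mod_cast h
    rw [hK2 (by linarith), hL2 (by linarith), max_eq_left (by linarith), abs_le]
    constructor <;> nlinarith [mul_nonneg (sub_nonneg.2 hm1) (sub_nonneg.2 hu1),
      mul_nonneg (sub_nonneg.2 hm1) (sub_nonneg.2 hu2),
      mul_nonneg (sub_nonneg.2 hm1') (sub_nonneg.2 hv1),
      mul_nonneg (sub_nonneg.2 hm1') (sub_nonneg.2 hv2),
      mul_nonneg (sub_nonneg.2 hu1) (sub_nonneg.2 hu2),
      mul_nonneg (sub_nonneg.2 hv1) (sub_nonneg.2 hv2)]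

/-- Both parameters are near half-integers. -/
theorem abs_le_of_mid_mid {n m m' : ℕ} (hn : 2 ≤ n) (hm : m + 1 ≤ n) (hm' : m' + 1 ≤ n)
    {x y K L : ℝ}
    (hx : |x - m - 1 / 2| ≤ 1 / 6) (hy : |y - m' - 1 / 2| ≤ 1 / 6)
    (hK1 : (m + 1 + (m' + 1) : ℝ) ≤ n + 1 → K = (m + 1) * (m' + 1))
    (hK2 : (n : ℝ) ≤ m + 1 + (m' + 1) →
      K = (m + 1) * (m' + 1) - (m + 1 + (m' + 1) - n) * (m + 1 + (m' + 1) - n - 1) / 2)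
    (hL1 : (m + m' : ℝ) ≤ n → L = m * m')
    (hL2 : (n : ℝ) - 1 ≤ m + m' → L = m * m' - (m + m' - n + 1) * (m + m' - n) / 2) :
    |2 * x * y - max (x + y - n) 0 ^ 2 - (K + L)| ≤ 2 / 3 * (n : ℝ) - 1 / 9 := by
  obtain ⟨u, rfl⟩ : ∃ u, x = m + 1 / 2 + u := ⟨x - m - 1 / 2, by ring⟩
  obtain ⟨v, rfl⟩ : ∃ v, y = m' + 1 / 2 + v := ⟨y - m' - 1 / 2, by ring⟩
  rw [show (m' : ℝ) + 1 / 2 + v - m' - 1 / 2 = v by ring, abs_le] at hy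
  rw [show (m : ℝ) + 1 / 2 + u - m - 1 / 2 = u by ring, abs_le] at hx
  have hn2 : (2 : ℝ) ≤ n := by exact_mod_cast hn
  have hm1 : (m : ℝ) + 1 ≤ n := by exact_mod_cast hm
  have hm1' : (m' : ℝ) + 1 ≤ n := by exact_mod_cast hm'
  have hm0 : (0 : ℝ) ≤ m := m.cast_nonneg
  have hm0' : (0 : ℝ) ≤ m' := m'.cast_nonneg
  obtain ⟨hu1, hu2⟩ := hx
  obtain ⟨hv1, hv2⟩ := hy
  rcases Nat.lt_or_ge (m + m') n with h | h
  · have h' : (m : ℝ) + m' + 1 ≤ n := by exact_mod_cast h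
    rw [hK1 (by linarith), hL1 (by linarith), abs_le]
    have hM0 : 0 ≤ max ((m : ℝ) + 1 / 2 + u + (m' + 1 / 2 + v) - n) 0 := le_max_right _ _
    have hM1 : max ((m : ℝ) + 1 / 2 + u + (m' + 1 / 2 + v) - n) 0 ≤ 1 / 3 :=
      max_le (by linarith) (by norm_num)
    generalize max ((m : ℝ) + 1 / 2 + u + (m' + 1 / 2 + v) - n) 0 = M at *
    constructor
    · nlinarith [mul_nonneg (show 0 ≤ m + 1 / 2 + u by linarith) (sub_nonneg.2 hv1)]
    · nlinarith [mul_nonneg (show 0 ≤ m + 1 / 2 + u by linarith) (sub_nonneg.2 hv2)]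
  · have h' : (n : ℝ) ≤ m + m' := by exact_mod_cast h
    rw [hK2 (by linarith), hL2 (by linarith), max_eq_left (by linarith), abs_le]
    constructor <;> nlinarith [mul_nonneg (sub_nonneg.2 hm1) (sub_nonneg.2 hu1),
      mul_nonneg (sub_nonneg.2 hm1) (sub_nonneg.2 hu2),
      mul_nonneg (sub_nonneg.2 hm1') (sub_nonneg.2 hv1),
      mul_nonneg (sub_nonneg.2 hm1') (sub_nonneg.2 hv2),
      mul_nonneg (sub_nonneg.2 hu1) (sub_nonneg.2 hu2),
      mul_nonneg (sub_nonneg.2 hv1) (sub_nonneg.2 hv2)]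

theorem abs_sub_gridSum_le {n : ℕ} (hn : 2 ≤ n) {x y : ℝ} (hx0 : 0 < x) (hxn : x ≤ n)
    (hy0 : 0 < y) (hyn : y ≤ n) :
    |2 * x * y - max (x + y - n) 0 ^ 2
      - (gridSum n (fun i j => if (i : ℝ) + 1 / 3 < x ∧ (j : ℝ) + 1 / 3 < y then 1 else 0)
        (fun i j => if (i : ℝ) + 2 / 3 < x ∧ (j : ℝ) + 2 / 3 < y then 1 else 0) : ℕ)|
      ≤ 2 / 3 * (n : ℝ) - 1 / 9 := by
  obtain ⟨p, q, hp, hq, hpi, hqi, hpq⟩ := exists_thirds n x hx0 hxn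
  obtain ⟨p', q', hp', hq', hpi', hqi', hpq'⟩ := exists_thirds n y hy0 hyn
  simp only [hpi, hqi, hpi', hqi']
  rw [gridSum_ite_lt hp hq hp' hq', Nat.cast_add]
  obtain ⟨hK1, hK2⟩ := sum_ite_add_lt n p p' (by omega) (by omega)
  obtain ⟨hL1, hL2⟩ := sum_ite_add_lt (n - 1) q q' (by omega) (by omega)
  rw [Nat.cast_sub (by omega : 1 ≤ n), Nat.cast_one] at hL1 hL2
  rw [show (q + q' : ℝ) - (n - 1) = q + q' - n + 1 by ring, add_sub_cancel_right] at hL2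
  rw [sub_add_cancel] at hL1
  generalize ((∑ i ∈ Finset.range p, ∑ j ∈ Finset.range p', if i + j < n then 1 else 0 : ℕ) : ℝ)
    = K at *
  generalize ((∑ i ∈ Finset.range q, ∑ j ∈ Finset.range q', if i + j < n - 1 then 1 else 0 : ℕ)
    : ℝ) = L at *
  rcases hpq with ⟨rfl, hx⟩ | ⟨rfl, hx⟩ <;> rcases hpq' with ⟨rfl, hy⟩ | ⟨rfl, hy⟩
  · exact abs_le_of_near_near hn hp hp' hx0 hxn hy0 hyn hx hy hK1 hK2 hL1 hL2
  · push_cast at hK1 hK2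
    exact abs_le_of_near_mid hn hp hp' hx0 hx hy hK1 hK2 hL1 hL2
  · push_cast at hK1 hK2
    rw [mul_right_comm, add_comm x y]
    refine abs_le_of_near_mid hn hp' hp hy0 hy hx (fun h => ?_) (fun h => ?_) (fun h => ?_)
      (fun h => ?_)
    · rw [hK1 (by linarith)]; ring
    · rw [hK2 (by linarith)]; ring
    · rw [hL1 (by linarith)]; ring
    · rw [hL2 (by linarith)]; ring
  · push_cast at hK1 hK2
    exact abs_le_of_mid_mid hn hp hp' hx hy hK1 hK2 hL1 hL2

theorem Nondeg.rotate {A B C : Pt} (h : Nondeg A B C) : Nondeg B C A := by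
  unfold Nondeg
  rwa [show ({B, C, A} : Set Pt) = {A, B, C} by
    rw [Set.pair_comm C A, Set.insert_comm]]

theorem triangle_rotate (A B C : Pt) : triangle B C A = triangle A B C := by
  unfold triangle
  rw [Set.pair_comm C A, Set.insert_comm]

theorem Nondeg.swap {A B C : Pt} (h : Nondeg A B C) : Nondeg A C B := by
  unfold Nondeg
  rwa [Set.pair_comm C B]

theorem triangle_swap (A B C : Pt) : triangle A C B = triangle A B C := by
  unfold triangle
  rw [Set.pair_comm C B]

theorem abs_sdisc_parlg_le {A B C : Pt} (h : Nondeg A B C) {k : ℕ} (hk : 1 ≤ k)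
    (P : Fin (4 ^ k) → Pt)
    (hP : ∀ g : Pt → ℕ, ∑ i, g (P i) = ∑ i ∈ Finset.range (4 ^ k), g (vdc (A, B, C) i))
    {a b : ℝ} (ha0 : 0 < a) (ha : a ≤ 1) (hb0 : 0 < b) (hb : b ≤ 1) :
    |sdisc (parlg A B C a b ∩ triangle A B C) P (triangle A B C)|
      ≤ 2 / (3 * 2 ^ k) - 1 / (9 * (2 ^ k) ^ 2) := by
  have hn : 2 ≤ 2 ^ k := Nat.le_self_pow (by omega) 2
  have hn0 : (0 : ℝ) < 2 ^ k := by positivity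
  rw [sdisc_parlg_eq h (n := 2 ^ k) (by positivity) P (fun g => by
    rw [hP, sum_vdc_eq_gridSum]; simp only [Nat.cast_pow, Nat.cast_ofNat]) ha0 ha hb0 hb]
  have hc : ((2 ^ k : ℕ) : ℝ) = 2 ^ k := by push_cast; rfl
  have hN : ((4 ^ k : ℕ) : ℝ) = (2 ^ k) ^ 2 := by
    push_cast
    rw [← pow_mul, mul_comm, pow_mul]
    norm_num
  have key := abs_sub_gridSum_le (x := (2 ^ k : ℕ) * a) (y := (2 ^ k : ℕ) * b) hn
    (by positivity) (by rw [hc]; nlinarith) (by positivity) (by rw [hc]; nlinarith)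
  generalize ((gridSum _ _ _ : ℕ) : ℝ) = K at *
  rw [hN]
  rw [hc] at key
  generalize (2 : ℝ) ^ k = n at *
  have hmax : max (n * a + n * b - n) 0 = n * max (a + b - 1) 0 := by
    rw [mul_max_of_nonneg _ _ hn0.le]
    ring_nf
  rw [hmax] at key
  have e : 2 * a * b - max (a + b - 1) 0 ^ 2 - K / n ^ 2
      = (2 * (n * a) * (n * b) - (n * max (a + b - 1) 0) ^ 2 - K) / n ^ 2 := by
    field_simp
  rw [e, abs_div, abs_of_pos (by positivity : 0 < n ^ 2), div_le_iff₀ (by positivity)]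
  refine key.trans_eq ?_
  field_simp

theorem sdisc_parlg_extremal {A B C : Pt} (h : Nondeg A B C) (k : ℕ)
    (P : Fin (4 ^ k) → Pt)
    (hP : ∀ g : Pt → ℕ, ∑ i, g (P i) = ∑ i ∈ Finset.range (4 ^ k), g (vdc (A, B, C) i)) :
    sdisc (parlg A B C 1 (1 / (3 * 2 ^ k)) ∩ triangle A B C) P (triangle A B C)
      = 2 / (3 * 2 ^ k) - 1 / (9 * (2 ^ k) ^ 2) := by
  have hn1 : (1 : ℝ) ≤ 2 ^ k := one_le_pow₀ (by norm_num)
  have hb0 : (0 : ℝ) < 1 / (3 * 2 ^ k) := by positivity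
  have hb1 : (1 : ℝ) / (3 * 2 ^ k) ≤ 1 := by
    rw [div_le_one (by positivity)]
    linarith
  rw [sdisc_parlg_eq h (n := 2 ^ k) (by positivity) P (fun g => by
    rw [hP, sum_vdc_eq_gridSum]; simp only [Nat.cast_pow, Nat.cast_ofNat]) one_pos le_rfl hb0 hb1]
  have hb : ((2 ^ k : ℕ) : ℝ) * (1 / (3 * 2 ^ k)) = 1 / 3 := by
    push_cast
    field_simp
  have h1 : ∀ j : ℕ, ¬ (j : ℝ) + 1 / 3 < 1 / 3 := fun j => by
    have : (0 : ℝ) ≤ j := j.cast_nonneg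
    linarith
  have h2 : ∀ j : ℕ, ¬ (j : ℝ) + 2 / 3 < 1 / 3 := fun j => by
    have : (0 : ℝ) ≤ j := j.cast_nonneg
    linarith
  have hzero : gridSum (2 ^ k) (fun _ _ => 0) (fun _ _ => 0) = 0 := by simp [gridSum]
  simp only [hb, h1, h2, and_false, if_false, hzero]
  rw [max_eq_left (by linarith)]
  push_cast
  field_simp
  ring

/-- for `N = 4^k`, `k ≥ 1`, the parallelogram discrepancy of the first `N`
triangular van der Corput points equals `2/(3√N) - 1/(9N)`. -/
theorem parDisc_vdc_pow_four (A B C : Pt) (h : Nondeg A B C) (k : ℕ) (hk : 1 ≤ k) :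
    parDisc (fun i : Fin (4 ^ k) => vdc (A, B, C) (i : ℕ)) A B C
      = 2 / (3 * Real.sqrt ((4 : ℝ) ^ k)) - 1 / (9 * (4 : ℝ) ^ k) := by
  have hn1 : (1 : ℝ) ≤ 2 ^ k := one_le_pow₀ (by norm_num)
  have h4 : (4 : ℝ) ^ k = (2 ^ k) ^ 2 := by
    rw [← pow_mul, mul_comm, pow_mul]
    norm_num
  rw [h4, Real.sqrt_sq (by positivity)]
  set P : Fin (4 ^ k) → Pt := fun i => vdc (A, B, C) (i : ℕ)
  have hP : ∀ g : Pt → ℕ, ∑ i, g (P i) = ∑ i ∈ Finset.range (4 ^ k), g (vdc (A, B, C) i) :=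
    fun g => Fin.sum_univ_eq_sum_range (fun i => g (vdc (A, B, C) i)) (4 ^ k)
  have hb1 : (1 : ℝ) / (3 * 2 ^ k) ≤ 1 := by
    rw [div_le_one (by positivity)]
    linarith
  have hmem : parlg A B C 1 (1 / (3 * 2 ^ k)) ∩ triangle A B C ∈ parFam A B C :=
    Or.inr ⟨1, 1 / (3 * 2 ^ k), one_pos, le_rfl, by positivity, hb1, rfl⟩
  have hle : ∀ S ∈ parFam A B C,
      |sdisc S P (triangle A B C)| ≤ 2 / (3 * 2 ^ k) - 1 / (9 * (2 ^ k) ^ 2) := by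
    rintro S ((⟨a, b, ha0, ha, hb0, hb, rfl⟩ | ⟨a, b, ha0, ha, hb0, hb, rfl⟩) |
      ⟨a, b, ha0, ha, hb0, hb, rfl⟩)
    · rw [← triangle_rotate A B C]
      exact abs_sdisc_parlg_le h.rotate hk P
        (fun g => (hP g).trans (sum_vdc_rotate k g A B C).symm) ha0 ha hb0 hb
    · rw [← triangle_swap A B C]
      exact abs_sdisc_parlg_le h.swap hk P
        (fun g => (hP g).trans (sum_vdc_swap k g A B C).symm) ha0 ha hb0 hb
    · exact abs_sdisc_parlg_le h hk P hP ha0 ha hb0 hb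
  have hval := sdisc_parlg_extremal h k P hP
  have hD0 : (0 : ℝ) ≤ 2 / (3 * 2 ^ k) - 1 / (9 * (2 ^ k) ^ 2) :=
    (abs_nonneg _).trans (hle _ hmem)
  have hle' : ∀ S, ⨆ _ : S ∈ parFam A B C, |sdisc S P (triangle A B C)|
      ≤ 2 / (3 * 2 ^ k) - 1 / (9 * (2 ^ k) ^ 2) := fun S => Real.iSup_le (hle S) hD0
  refine le_antisymm (Real.iSup_le hle' hD0) ?_
  refine le_trans ?_ (le_ciSup ⟨_, Set.forall_mem_range.2 hle'⟩
    (parlg A B C 1 (1 / (3 * 2 ^ k)) ∩ triangle A B C))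
  rw [ciSup_pos hmem, hval]
  exact le_abs_self _
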